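/- arXiv:2002.03706 — 7 statements merged into one kernel-verified Lean document; each statement's English description precedes it below -/
import Mathlib

section
/- Let F_q be a finite field with q elements, let m_1 = x_1^{e_1}···x_n^{e_n} and m_2 = x_1^{f_1}···x_n^{f_n} be two distinct monomials in n variables whose exponents all satisfy 0 ≤ e_i, f_i ≤ D with D < q − 1, and let c be a nonzero element of F_q. Then the number of n-tuples (α_1, …, α_n) ∈ (F_q^*)^n such that m_1(α_1, …, α_n) = c · m_2(α_1, …, α_n) is at most D(q−1)^{n−1}. -/
/-- In the unit group of a finite field, `x ^ k = u` has at most `k` solutions when `k > 0`. -/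
theorem card_filter_units_pow_eq_le {F : Type*} [Field F] [Fintype F] [DecidableEq F]
    {k : ℕ} (hk : 0 < k) (u : Fˣ) :
    (Finset.univ.filter fun x : Fˣ => x ^ k = u).card ≤ k := by
  calc (Finset.univ.filter fun x : Fˣ => x ^ k = u).card
      ≤ (Polynomial.nthRoots k (u : F)).toFinset.card := by
        refine Finset.card_le_card_of_injOn (fun x => (x : F)) ?_ Units.val_injective.injOn
        intro x hx
        have hx' : x ^ k = u := by simpa using hx
        simp [Polynomial.mem_nthRoots hk, ← hx']
    _ ≤ (Polynomial.nthRoots k (u : F)).card := Multiset.toFinset_card_le _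
    _ ≤ k := Polynomial.card_nthRoots k _

/-- A binomial equation `x ^ a * u = x ^ b * v` with `a ≠ b` and `a, b ≤ D` has at most `D`
solutions in the unit group of a finite field. -/
theorem card_filter_units_binomial_le {F : Type*} [Field F] [Fintype F] [DecidableEq F]
    {a b D : ℕ} (hab : a ≠ b) (ha : a ≤ D) (hb : b ≤ D) (u v : Fˣ) :
    (Finset.univ.filter fun x : Fˣ => x ^ a * u = x ^ b * v).card ≤ D := by
  wlog h : b < a generalizing a b u v
  · simpa only [eq_comm] using this hab.symm hb ha v u (by omega)
  refine le_trans (Finset.card_le_card fun x hx => ?_)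
    ((card_filter_units_pow_eq_le (Nat.sub_pos_of_lt h) (v * u⁻¹)).trans (by omega))
  simp only [Finset.mem_filter, Finset.mem_univ, true_and] at hx ⊢
  rw [← Nat.add_sub_of_le h.le, pow_add, mul_assoc, mul_right_inj] at hx
  rw [eq_mul_inv_iff_mul_eq]
  simpa using hx

/-- For a finite field `F` with `q` elements, two distinct monomials
`m₁ = x₁^{e 1} ⋯ xₙ^{e n}` and `m₂ = x₁^{f 1} ⋯ xₙ^{f n}` with all exponents at most
`D < q - 1`, and a nonzero `c ∈ F`, the number of tuples `α ∈ (Fˣ)ⁿ` with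
`m₁(α) = c · m₂(α)` is at most `D (q-1)^{n-1}`. -/
theorem stmt0 (F : Type*) [Field F] [Fintype F] (q n D : ℕ)
    (hq : Fintype.card F = q)
    (e f : Fin n → ℕ) (hef : e ≠ f)
    (he : ∀ i, e i ≤ D) (hf : ∀ i, f i ≤ D) (hD : D < q - 1)
    (c : Fˣ) :
    Nat.card {α : Fin n → Fˣ // (∏ i, α i ^ e i) = c * ∏ i, α i ^ f i} ≤
      D * (q - 1) ^ (n - 1) := by
  classical
  obtain ⟨i, hi⟩ := Function.ne_iff.mp hef
  obtain _ | m := n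
  · exact i.elim0
  rw [Nat.card_eq_fintype_card, Fintype.card_subtype]
  have hcard : (Finset.univ : Finset (Fin m → Fˣ)).card = (q - 1) ^ (m + 1 - 1) := by
    simp [Fintype.card_units, hq]
  rw [← hcard]
  refine Finset.card_le_mul_card_image_of_maps_to (f := fun α => i.removeNth α)
    (fun _ _ => Finset.mem_univ _) D fun β _ => ?_
  refine le_trans (Finset.card_le_card_of_injOn (fun α => α i) ?_ ?_)
    (card_filter_units_binomial_le hi (he i) (hf i)
      (∏ j, β j ^ e (i.succAbove j)) (c * ∏ j, β j ^ f (i.succAbove j)))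
  · intro α hα
    simp only [Finset.coe_filter, Finset.mem_filter, Finset.mem_univ, true_and,
      Set.mem_ofPred_eq] at hα ⊢
    obtain ⟨h, rfl⟩ := hα
    rw [Fin.prod_univ_succAbove _ i, Fin.prod_univ_succAbove _ i, mul_left_comm] at h
    exact h
  · intro α hα α' hα' h
    simp only [Finset.coe_filter, Finset.mem_filter, Finset.mem_univ, true_and,
      Set.mem_ofPred_eq] at hα hα'
    rw [← Fin.insertNth_self_removeNth i α, ← Fin.insertNth_self_removeNth i α', hα.2, hα'.2]
    exact congrArg (fun x : Fˣ => (i.insertNth x β : Fin (m + 1) → Fˣ)) h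
end

section
/- Let F_q be a finite field with q elements and let f = c_1 m_1 + ⋯ + c_t m_t be an n-variable polynomial over F_q with pairwise distinct monomials m_i and nonzero coefficients c_i, where every partial degree of f is at most D and D < q − 1. Let ω ∈ F_q^*, let T ≥ t, and suppose (α_1, …, α_n, ζ_1, …, ζ_n) is chosen uniformly at random from (F_q^*)^{2n}. Then with probability at least 1 − (n+2)T(T−1)D / (2(q−1)), all three of the following hold: (A1) the values m_i(α_1, …, α_n), i = 1, …, t, are pairwise distinct; (A2) for every k ∈ {1, …, n}, the values m_i(α_1, …, α_{k−1}, α_k ω, α_{k+1}, …, α_n), i = 1, …, t, are pairwise distinct; (A3) the values c_i · m_i(ζ_1, …, ζ_n), i = 1, …, t, are pairwise distinct. -/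
open Finset Polynomial in
/-- A two-term equation `A x ^ i = B x ^ j` with distinct `i, j ≤ D` has at most `D` solutions among
the units of a field. -/
theorem card_units_mul_pow_eq_le {F : Type*} [Field F] {D i j : ℕ} (hij : i ≠ j)
    (hi : i ≤ D) (hj : j ≤ D) (A B : Fˣ) (s : Finset Fˣ)
    (hs : ∀ x ∈ s, A * x ^ i = B * x ^ j) : #s ≤ D := by
  classical
  set P : F[X] := C (A : F) * X ^ i - C (B : F) * X ^ j with hP
  have hP0 : P ≠ 0 := by
    intro h
    have h1 : P.coeff i = A := by simp [hP, coeff_X_pow, hij]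
    exact A.ne_zero (by rw [← h1, h, coeff_zero])
  have hdeg : P.natDegree ≤ D :=
    (natDegree_sub_le _ _).trans
      (max_le ((natDegree_C_mul_X_pow_le _ _).trans hi) ((natDegree_C_mul_X_pow_le _ _).trans hj))
  have hsub : s.image (fun x : Fˣ => (x : F)) ⊆ P.roots.toFinset := by
    intro y hy
    obtain ⟨x, hx, rfl⟩ := mem_image.1 hy
    rw [Multiset.mem_toFinset, mem_roots hP0]
    have := congrArg (fun u : Fˣ => (u : F)) (hs x hx)
    simp only [Units.val_mul, Units.val_pow_eq_pow_val] at this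
    simp [hP, IsRoot, this]
  calc #s = #(s.image fun x : Fˣ => (x : F)) := (card_image_of_injective _ Units.val_injective).symm
    _ ≤ #P.roots.toFinset := card_le_card hsub
    _ ≤ P.roots.card := Multiset.toFinset_card_le _
    _ ≤ D := (card_roots' P).trans hdeg

open Finset in
/-- Two distinct monomials with partial degrees at most `D`, scaled by units, agree at no more than
a fraction `D / |Fˣ|` of the points with nonzero coordinates. -/
theorem card_units_mul_card_monomial_eq_le {F ι : Type*} [Field F] [Fintype Fˣ] [DecidableEq Fˣ]
    [Fintype ι] [DecidableEq ι] {D : ℕ} {u v : ι → ℕ} (huv : u ≠ v)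
    (hu : ∀ k, u k ≤ D) (hv : ∀ k, v k ≤ D) (A B : Fˣ) :
    Fintype.card Fˣ * #{a : ι → Fˣ | A * ∏ k, a k ^ u k = B * ∏ k, a k ^ v k} ≤
      D * Fintype.card Fˣ ^ Fintype.card ι := by
  obtain ⟨k, hk⟩ := Function.ne_iff.1 huv
  let f : (ι → Fˣ) → ({j // j ≠ k} → Fˣ) := fun a j => a j
  set s : Finset (ι → Fˣ) := {a | A * ∏ k, a k ^ u k = B * ∏ k, a k ^ v k} with hs
  have hfib : ∀ r ∈ s.image f, #{a ∈ s | f a = r} ≤ D := by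
    intro r _
    have hinj : Set.InjOn (fun a : ι → Fˣ => a k) ({a ∈ s | f a = r} : Finset (ι → Fˣ)) := by
      intro a ha b hb hab
      simp only [coe_filter, Set.mem_ofPred_eq] at ha hb
      funext j
      by_cases hj : j = k
      · subst hj; exact hab
      · exact congrFun (ha.2.trans hb.2.symm) ⟨j, hj⟩
    rw [← card_image_of_injOn hinj]
    refine card_units_mul_pow_eq_le hk (hu k) (hv k) (A * ∏ j, r j ^ u j) (B * ∏ j, r j ^ v j) _ ?_
    intro x hx
    obtain ⟨a, ha, rfl⟩ := mem_image.1 hx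
    obtain ⟨has, rfl⟩ := mem_filter.1 ha
    have h := (mem_filter.1 has).2
    rw [Fintype.prod_eq_mul_prod_subtype_ne _ k, Fintype.prod_eq_mul_prod_subtype_ne _ k] at h
    simp only [f]
    rw [mul_assoc, mul_comm (∏ _, _), h, mul_assoc, mul_comm (∏ _, _)]
  have hcard : Fintype.card Fˣ ^ Fintype.card ι =
      Fintype.card Fˣ * Fintype.card ({j // j ≠ k} → Fˣ) := by
    rw [← Fintype.card_prod, ← Fintype.card_congr (Equiv.funSplitAt k Fˣ), Fintype.card_fun]
  calc Fintype.card Fˣ * #s ≤ Fintype.card Fˣ * (D * #(s.image f)) :=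
        Nat.mul_le_mul_left _ (card_le_mul_card_image s D hfib)
    _ ≤ Fintype.card Fˣ * (D * Fintype.card ({j // j ≠ k} → Fˣ)) := by
        gcongr; exact card_le_univ _
    _ = D * Fintype.card Fˣ ^ Fintype.card ι := by rw [hcard]; ring

open Finset in
theorem Fin.card_filter_fst_lt_snd_mul_two (t : ℕ) :
    #{p : Fin t × Fin t | p.1 < p.2} * 2 = t * (t - 1) := by
  rw [← Finset.sum_range_id_mul_two, ← Fin.sum_univ_eq_sum_range (fun i => i),
    ← univ_product_univ, card_filter, sum_product_right]
  congr 1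
  refine sum_congr rfl fun j _ => ?_
  rw [← card_filter, ← Fin.card_Iio]
  congr 1
  ext i
  simp

open Finset in
/-- Union bound for the collision of two among `t` distinct scaled monomials. -/
theorem card_not_injective_monomials_le {F ι : Type*} [Field F] [Fintype Fˣ] [DecidableEq Fˣ]
    [Fintype ι] [DecidableEq ι] {D t : ℕ} {e : Fin t → ι → ℕ} (he : Function.Injective e)
    (hD : ∀ i k, e i k ≤ D) (w : Fin t → Fˣ) :
    2 * Fintype.card Fˣ *
        #{a : ι → Fˣ | ¬ Function.Injective fun i => w i * ∏ k, a k ^ e i k} ≤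
      t * (t - 1) * (D * Fintype.card Fˣ ^ Fintype.card ι) := by
  set P : Finset (Fin t × Fin t) := {p | p.1 < p.2} with hP
  let S : Fin t × Fin t → Finset (ι → Fˣ) := fun p =>
    {a | w p.1 * ∏ k, a k ^ e p.1 k = w p.2 * ∏ k, a k ^ e p.2 k}
  have hsub : ({a : ι → Fˣ | ¬ Function.Injective fun i => w i * ∏ k, a k ^ e i k} : Finset _) ⊆
      P.biUnion S := by
    intro a ha
    have ha := (mem_filter.1 ha).2
    simp only [Function.Injective, not_forall] at ha
    obtain ⟨i, j, h, hij⟩ := ha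
    rw [mem_biUnion]
    rcases lt_or_gt_of_ne hij with hlt | hlt
    · exact ⟨(i, j), by simpa [hP] using hlt, by simpa [S] using h⟩
    · exact ⟨(j, i), by simpa [hP] using hlt, by simpa [S] using h.symm⟩
  calc _ ≤ 2 * Fintype.card Fˣ * ∑ p ∈ P, #(S p) :=
        Nat.mul_le_mul_left _ ((card_le_card hsub).trans card_biUnion_le)
    _ = 2 * ∑ p ∈ P, Fintype.card Fˣ * #(S p) := by rw [mul_assoc, mul_sum]
    _ ≤ 2 * ∑ p ∈ P, D * Fintype.card Fˣ ^ Fintype.card ι := by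
        refine Nat.mul_le_mul_left _ (sum_le_sum fun p hp => ?_)
        exact card_units_mul_card_monomial_eq_le
          (he.ne (mem_filter.1 hp).2.ne) (hD _) (hD _) _ _
    _ = #P * 2 * (D * Fintype.card Fˣ ^ Fintype.card ι) := by
        rw [sum_const, smul_eq_mul]; ring
    _ = _ := by rw [hP, Fin.card_filter_fst_lt_snd_mul_two]

theorem prod_ite_mul_pow {G ι : Type*} [CommMonoid G] [Fintype ι] [DecidableEq ι]
    (k₀ : ι) (a : ι → G) (ω : G) (u : ι → ℕ) :
    ∏ k, (if k = k₀ then a k * ω else a k) ^ u k = ω ^ u k₀ * ∏ k, a k ^ u k := by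
  have h : ∀ k, (if k = k₀ then a k * ω else a k) ^ u k =
      (if k = k₀ then ω ^ u k else 1) * a k ^ u k := by
    intro k
    split_ifs
    · rw [mul_pow, mul_comm]
    · rw [one_mul]
  simp_rw [h, Finset.prod_mul_distrib, Finset.prod_ite_eq' Finset.univ k₀,
    if_pos (Finset.mem_univ k₀)]


/-- For a sparse polynomial `f = ∑ cᵢ mᵢ` over a finite field with `q` elements,
with pairwise distinct monomials (exponent vectors `e i`), nonzero coefficients `c i`,
partial degrees at most `D < q - 1`, any `ω ∈ Fˣ` and `T ≥ t`, a uniformly random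
`(α, ζ) ∈ (Fˣ)^{2n}` satisfies Assumptions 1, 2, 3 with probability at least
`1 - (n+2)T(T-1)D / (2(q-1))`. -/
theorem stmt2 (F : Type*) [Field F] [Fintype F] (q n D t T : ℕ)
    (hq : Fintype.card F = q)
    (e : Fin t → Fin n → ℕ) (he : Function.Injective e)
    (c : Fin t → Fˣ)
    (hD : ∀ i k, e i k ≤ D) (hDq : D < q - 1)
    (ω : Fˣ) (hT : t ≤ T) :
    (1 : ℝ) - ((n : ℝ) + 2) * T * ((T : ℝ) - 1) * D / (2 * ((q : ℝ) - 1)) ≤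
      (Nat.card {p : (Fin n → Fˣ) × (Fin n → Fˣ) //
        (Function.Injective fun i => ∏ k, (p.1 k) ^ e i k) ∧
        (∀ k0 : Fin n, Function.Injective fun i =>
          ∏ k, (if k = k0 then p.1 k * ω else p.1 k) ^ e i k) ∧
        (Function.Injective fun i => c i * ∏ k, (p.2 k) ^ e i k)} : ℝ) /
        (((q : ℝ) - 1) ^ (2 * n)) := by
  classical
  let N := Fintype.card Fˣ
  have hN : 0 < N := Fintype.card_pos
  have hNq : (q : ℝ) - 1 = N := by
    have h : N + 1 = q := by rw [← hq, Fintype.card_eq_card_units_add_one]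
    rw [← h]; push_cast; ring
  let B : (Fin t → Fˣ) → Finset (Fin n → Fˣ) := fun w =>
    {a | ¬ Function.Injective fun i => w i * ∏ k, a k ^ e i k}
  have hB : ∀ w, 2 * N * (B w).card ≤ t * (t - 1) * (D * N ^ n) := fun w => by
    simpa [B, N] using card_not_injective_monomials_le he hD w
  let Q : (Fin n → Fˣ) × (Fin n → Fˣ) → Prop := fun p =>
    (Function.Injective fun i => ∏ k, (p.1 k) ^ e i k) ∧
    (∀ k0 : Fin n, Function.Injective fun i =>
      ∏ k, (if k = k0 then p.1 k * ω else p.1 k) ^ e i k) ∧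
    (Function.Injective fun i => c i * ∏ k, (p.2 k) ^ e i k)
  let good : Finset ((Fin n → Fˣ) × (Fin n → Fˣ)) := Finset.univ.filter Q
  let bad : Finset ((Fin n → Fˣ) × (Fin n → Fˣ)) := Finset.univ.filter fun p => ¬ Q p
  have hgood : Nat.card {p // Q p} = good.card := by
    rw [Nat.card_eq_fintype_card, Fintype.card_subtype]
  have htot : good.card + bad.card = N ^ n * N ^ n := by
    rw [Finset.card_filter_add_card_filter_not]
    simp [N]
  let A : Finset (Fin n → Fˣ) := B 1 ∪ Finset.univ.biUnion fun k₀ => B fun i => ω ^ e i k₀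
  have hbad : bad ⊆ A ×ˢ Finset.univ ∪ Finset.univ ×ˢ B c := by
    intro p hp
    have hp := (Finset.mem_filter.1 hp).2
    contrapose! hp
    simp only [A, B, Finset.mem_union, Finset.mem_product, Finset.mem_biUnion, Finset.mem_filter,
      Finset.mem_univ, true_and, and_true, not_or, not_exists, not_not, Pi.one_apply,
      one_mul] at hp
    refine ⟨hp.1.1, fun k₀ => ?_, hp.2⟩
    simpa only [prod_ite_mul_pow] using hp.1.2 k₀
  have hA : 2 * N * A.card ≤ (n + 1) * (t * (t - 1) * (D * N ^ n)) := by
    calc 2 * N * A.card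
        ≤ 2 * N * ((B 1).card + ∑ k₀, (B fun i => ω ^ e i k₀).card) :=
          Nat.mul_le_mul_left _ ((Finset.card_union_le _ _).trans
            (Nat.add_le_add_left Finset.card_biUnion_le _))
      _ = 2 * N * (B 1).card + ∑ k₀, 2 * N * (B fun i => ω ^ e i k₀).card := by
          rw [mul_add, Finset.mul_sum]
      _ ≤ t * (t - 1) * (D * N ^ n) + ∑ _k₀ : Fin n, t * (t - 1) * (D * N ^ n) :=
          Nat.add_le_add (hB _) (Finset.sum_le_sum fun _ _ => hB _)
      _ = _ := by simp; ring
  have hcard : bad.card ≤ A.card * N ^ n + N ^ n * (B c).card := by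
    refine (Finset.card_le_card hbad).trans ((Finset.card_union_le _ _).trans (le_of_eq ?_))
    simp [Finset.card_product, N]
  have hTt : t * (t - 1) ≤ T * (T - 1) := Nat.mul_le_mul hT (Nat.sub_le_sub_right hT 1)
  have hmain : 2 * N * bad.card ≤ (n + 2) * (T * (T - 1)) * D * (N ^ n * N ^ n) := by
    calc 2 * N * bad.card ≤ 2 * N * (A.card * N ^ n + N ^ n * (B c).card) :=
          Nat.mul_le_mul_left _ hcard
      _ = (2 * N * A.card + 2 * N * (B c).card) * N ^ n := by ring
      _ ≤ ((n + 1) * (t * (t - 1) * (D * N ^ n)) + t * (t - 1) * (D * N ^ n)) * N ^ n :=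
          Nat.mul_le_mul_right _ (Nat.add_le_add hA (hB c))
      _ = (n + 2) * (t * (t - 1)) * D * (N ^ n * N ^ n) := by ring
      _ ≤ _ := by gcongr
  have hTcast : ((T * (T - 1) : ℕ) : ℝ) = T * ((T : ℝ) - 1) := by
    cases T <;> simp
  have hmain' : 2 * (N : ℝ) * bad.card ≤
      ((n : ℝ) + 2) * (T * ((T : ℝ) - 1)) * D * ((N : ℝ) ^ n * (N : ℝ) ^ n) := by
    rw [← hTcast]; exact_mod_cast hmain
  have htot' : (good.card : ℝ) + bad.card = (N : ℝ) ^ n * (N : ℝ) ^ n := by exact_mod_cast htot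
  have hN' : (0 : ℝ) < N := by exact_mod_cast hN
  change _ ≤ (Nat.card {p // Q p} : ℝ) / _
  rw [hgood, hNq, two_mul n, pow_add, le_div_iff₀ (by positivity), sub_mul, one_mul,
    sub_le_comm, ← htot', add_sub_cancel_left, htot', div_mul_eq_mul_div, le_div_iff₀ (by positivity)]
  linarith
end

section
/- Let F_q be a finite field with q elements and let m_1, …, m_t be pairwise distinct monomials in n variables whose exponents all lie in [0, D] with D < q − 1. Then the number of tuples (α_1, …, α_n) ∈ (F_q^*)^n for which there exist indices i ≠ j with m_i(α_1, …, α_n) = m_j(α_1, …, α_n) is at most t(t−1)D(q−1)^{n−1}/2. -/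
open Finset in
theorem card_units_pow_eq_le {F : Type*} [Field F] [Fintype F] [DecidableEq F] {d : ℕ}
    (hd : 0 < d) (u : Fˣ) : #{x : Fˣ | x ^ d = u} ≤ d := by
  refine le_trans ?_ (Polynomial.card_nthRoots d (u : F))
  refine le_trans ?_ (Multiset.toFinset_card_le _)
  refine card_le_card_of_injOn (fun x => (x : F)) ?_ (fun x _ y _ h => Units.ext h)
  intro x hx
  have hx' : x ^ d = u := by simpa using hx
  simp [Polynomial.mem_nthRoots hd, ← hx']

open Finset in
theorem card_units_pow_mul_eq_le {F : Type*} [Field F] [Fintype F] [DecidableEq F]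
    {a b D : ℕ} (hab : a ≠ b) (ha : a ≤ D) (hb : b ≤ D) (u v : Fˣ) :
    #{x : Fˣ | x ^ a * u = x ^ b * v} ≤ D := by
  wlog h : a < b generalizing a b u v
  · simpa only [eq_comm] using this hab.symm hb ha v u (by omega)
  refine le_trans ?_ ((card_units_pow_eq_le (d := b - a) (by omega) (u * v⁻¹)).trans (by omega))
  refine card_le_card fun x hx => ?_
  have hx' : x ^ a * u = x ^ b * v := by simpa using hx
  have hpow : x ^ b = x ^ a * x ^ (b - a) := by rw [← pow_add]; congr 1; omega
  rw [hpow, mul_assoc] at hx'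
  simp [mul_left_cancel hx']

open Finset in
theorem card_monomial_eq_le {F : Type*} [Field F] [Fintype F] [DecidableEq F] {n D : ℕ}
    {a b : Fin n → ℕ} (hab : a ≠ b) (ha : ∀ k, a k ≤ D) (hb : ∀ k, b k ≤ D) :
    #{α : Fin n → Fˣ | ∏ k, α k ^ a k = ∏ k, α k ^ b k} ≤
      D * (Fintype.card F - 1) ^ (n - 1) := by
  obtain ⟨k, hk⟩ := Function.ne_iff.mp hab
  have hcard : #(univ : Finset ({l : Fin n // l ≠ k} → Fˣ)) =
      (Fintype.card F - 1) ^ (n - 1) := by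
    simp [Fintype.card_units, Fintype.card_subtype_compl]
  rw [← hcard]
  refine card_le_mul_card_image_of_maps_to (f := fun α l => α l.1) (fun _ _ => mem_univ _) D
    fun β _ => ?_
  have hprod (c : Fin n → ℕ) (α : Fin n → Fˣ) :
      ∏ l, α l ^ c l = α k ^ c k * ∏ l : {l : Fin n // l ≠ k}, α l ^ c l :=
    Fintype.prod_eq_mul_prod_subtype_ne (fun l => α l ^ c l) k
  refine le_trans ?_ (card_units_pow_mul_eq_le hk (ha k) (hb k)
    (∏ l : {l : Fin n // l ≠ k}, β l ^ a l) (∏ l : {l : Fin n // l ≠ k}, β l ^ b l))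
  refine card_le_card_of_injOn (fun α => α k) ?_ ?_
  · intro α hα
    obtain ⟨hα, rfl⟩ : ∏ l, α l ^ a l = ∏ l, α l ^ b l ∧
        (fun l : {l : Fin n // l ≠ k} => α l) = β := by simpa using hα
    simpa [hprod] using hα
  · intro α hα γ hγ h
    have hαβ : (fun l : {l : Fin n // l ≠ k} => α l) = β := (mem_filter.mp hα).2
    have hγβ : (fun l : {l : Fin n // l ≠ k} => γ l) = β := (mem_filter.mp hγ).2
    funext l
    by_cases hl : l = k
    · exact hl ▸ h
    · exact congrFun (hαβ.trans hγβ.symm) ⟨l, hl⟩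

/-- For pairwise distinct monomials `m₁, …, m_t` in `n` variables over a finite
field with `q` elements, all exponents at most `D < q - 1`, the number of tuples
`α ∈ (Fˣ)ⁿ` at which two distinct monomials collide is at most `t(t-1)D(q-1)^{n-1}/2`. -/
theorem stmt3 (F : Type*) [Field F] [Fintype F] (q n D t : ℕ)
    (hq : Fintype.card F = q)
    (e : Fin t → Fin n → ℕ) (he : Function.Injective e)
    (hD : ∀ i k, e i k ≤ D) (hDq : D < q - 1) :
    Nat.card {α : Fin n → Fˣ // ∃ i j : Fin t, i ≠ j ∧
        (∏ k, α k ^ e i k) = ∏ k, α k ^ e j k} ≤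
      t * (t - 1) * D * (q - 1) ^ (n - 1) / 2 := by
  classical
  subst hq
  set B := D * (Fintype.card F - 1) ^ (n - 1) with hB
  let S (i j : Fin t) : Finset (Fin n → Fˣ) :=
    {α | ∏ k, α k ^ e i k = ∏ k, α k ^ e j k}
  have hS (j : Fin t) : ((Finset.Iio j).biUnion fun i => S i j).card ≤ j * B := by
    simpa using Finset.card_biUnion_le_card_mul (Finset.Iio j) (fun i => S i j) B fun i hi =>
      card_monomial_eq_le (he.ne (Finset.mem_Iio.mp hi).ne) (hD i) (hD j)
  have hunion : Nat.card {α : Fin n → Fˣ // ∃ i j : Fin t, i ≠ j ∧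
      (∏ k, α k ^ e i k) = ∏ k, α k ^ e j k} ≤ (∑ j : Fin t, (j : ℕ)) * B := by
    rw [Nat.card_eq_fintype_card, Fintype.card_subtype, Finset.sum_mul]
    refine le_trans (Finset.card_le_card fun α hα => ?_)
      (Finset.card_biUnion_le.trans (Finset.sum_le_sum fun j _ => hS j))
    obtain ⟨i, j, hij, h⟩ := (Finset.mem_filter.mp hα).2
    simp only [Finset.mem_biUnion, Finset.mem_univ, true_and, Finset.mem_Iio, S,
      Finset.mem_filter]
    rcases hij.lt_or_gt with hlt | hlt
    · exact ⟨j, i, hlt, h⟩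
    · exact ⟨i, j, hlt, h.symm⟩
  rw [Nat.le_div_iff_mul_le two_pos, mul_assoc, ← hB, ← Finset.sum_range_id_mul_two,
    ← Fin.sum_univ_eq_sum_range (fun i => i), mul_right_comm]
  exact Nat.mul_le_mul_right 2 hunion
end

section
/- Let F_q be a finite field with q elements and let f = c_1 m_1 + ⋯ + c_t m_t be an n-variable polynomial over F_q with pairwise distinct monomials m_i, nonzero coefficients c_i, all partial degrees at most D, and D < q − 1. Then the number of tuples (ζ_1, …, ζ_n) ∈ (F_q^*)^n for which there exist indices i ≠ j with c_i · m_i(ζ_1, …, ζ_n) = c_j · m_j(ζ_1, …, ζ_n) is at most t(t−1)D(q−1)^{n−1}/2. Consequently, for a uniformly random (ζ_1, …, ζ_n) ∈ (F_q^*)^n, the polynomial f(ζ_1 x_1, …, ζ_n x_n) is diverse (all its coefficients are pairwise distinct) with probability at least 1 − t(t−1)D/(2(q−1)). -/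
open Polynomial in
/-- An equation `u * x ^ a = v * x ^ b` with `a ≠ b` has at most `D` solutions among the units
of a finite field as soon as `a, b ≤ D`. -/
theorem card_units_mul_pow_eq_mul_pow_le {F : Type*} [Field F] [Fintype F] [DecidableEq F]
    (u v : Fˣ) {a b D : ℕ} (hab : a ≠ b) (ha : a ≤ D) (hb : b ≤ D) :
    (Finset.univ.filter fun x : Fˣ => u * x ^ a = v * x ^ b).card ≤ D := by
  set p : F[X] := C (u : F) * X ^ a - C (v : F) * X ^ b with hp
  have hp0 : p ≠ 0 := by
    intro h
    have := congrArg (fun r : F[X] => r.coeff a) h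
    simp [hp, coeff_X_pow, hab] at this
  have hdeg : p.natDegree ≤ D :=
    (natDegree_sub_le _ _).trans <| max_le ((natDegree_C_mul_X_pow_le _ _).trans ha)
      ((natDegree_C_mul_X_pow_le _ _).trans hb)
  calc _ = ((Finset.univ.filter fun x : Fˣ => u * x ^ a = v * x ^ b).map
          ⟨Units.val, Units.val_injective⟩).card := (Finset.card_map _).symm
    _ ≤ p.roots.toFinset.card := by
        refine Finset.card_le_card fun y hy => ?_
        obtain ⟨x, hx, rfl⟩ := Finset.mem_map.1 hy
        have hx' := congrArg Units.val (Finset.mem_filter.1 hx).2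
        push_cast at hx'
        rw [Multiset.mem_toFinset, mem_roots hp0]
        simp [IsRoot, hp, hx']
    _ ≤ D := (Multiset.toFinset_card_le _).trans ((card_roots' p).trans hdeg)

/-- Two distinct monomials with nonzero coefficients and partial degrees at most `D` agree on at
most `D (q - 1) ^ (n - 1)` points of the torus `(Fˣ)ⁿ`. -/
theorem card_monomial_eq_monomial_le {F : Type*} [Field F] [Fintype F] [DecidableEq F]
    {n D : ℕ} (u v : Fˣ) {a b : Fin n → ℕ} (hab : a ≠ b)
    (ha : ∀ k, a k ≤ D) (hb : ∀ k, b k ≤ D) :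
    (Finset.univ.filter fun ζ : Fin n → Fˣ =>
      u * ∏ k, ζ k ^ a k = v * ∏ k, ζ k ^ b k).card ≤
        D * (Fintype.card F - 1) ^ (n - 1) := by
  obtain ⟨k, hk⟩ := Function.ne_iff.1 hab
  cases n with
  | zero => exact k.elim0
  | succ m =>
    have hcard : (Finset.univ : Finset (Fin m → Fˣ)).card =
        (Fintype.card F - 1) ^ (m + 1 - 1) := by
      simp [Fintype.card_units]
    rw [← hcard]
    refine Finset.card_le_mul_card_image_of_maps_to (f := fun ζ => k.removeNth ζ)
      (fun _ _ => Finset.mem_univ _) D fun r _ => ?_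
    refine le_trans ?_ (card_units_mul_pow_eq_mul_pow_le
      (u * ∏ i, r i ^ a (k.succAbove i)) (v * ∏ i, r i ^ b (k.succAbove i)) hk (ha k) (hb k))
    refine Finset.card_le_card_of_injOn (fun ζ => ζ k) (fun ζ hζ => ?_) fun ζ hζ ξ hξ h => ?_
    · simp only [Finset.coe_filter, Finset.mem_filter, Finset.mem_univ, true_and,
        Set.mem_ofPred_eq] at hζ ⊢
      obtain ⟨h, rfl⟩ := hζ
      rw [Fin.prod_univ_succAbove _ k, Fin.prod_univ_succAbove _ k] at h
      simp only [Fin.removeNth]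
      rw [mul_assoc, mul_assoc, mul_comm _ (ζ k ^ a k), mul_comm _ (ζ k ^ b k)]
      exact h
    · simp only [Finset.coe_filter, Finset.mem_filter, Finset.mem_univ, true_and,
        Set.mem_ofPred_eq] at hζ hξ
      rw [← Fin.insertNth_self_removeNth k ζ, ← Fin.insertNth_self_removeNth k ξ, hζ.2, hξ.2]
      exact congrArg (fun x => (k.insertNth x r : Fin (m + 1) → Fˣ)) h

theorem card_filter_fst_lt_snd (t : ℕ) :
    (Finset.univ.filter fun p : Fin t × Fin t => p.1 < p.2).card = t * (t - 1) / 2 := by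
  have h : (Finset.univ.filter fun p : Fin t × Fin t => p.1 < p.2).card =
      ∑ j : Fin t, (Finset.Iio j).card := by
    rw [Finset.card_filter, Fintype.sum_prod_type_right]
    refine Finset.sum_congr rfl fun j _ => ?_
    rw [← Finset.card_filter]
    congr 1
    ext i
    simp
  rw [h, ← Finset.sum_range_id, ← Fin.sum_univ_eq_sum_range]
  simp

/-- Bound for the number of points of the torus at which two of the monomials `cᵢ mᵢ` collide. -/
theorem card_exists_monomial_eq_le {F : Type*} [Field F] [Fintype F] {n D t : ℕ}
    (e : Fin t → Fin n → ℕ) (he : Function.Injective e) (c : Fin t → Fˣ)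
    (hD : ∀ i k, e i k ≤ D) :
    Nat.card {ζ : Fin n → Fˣ // ∃ i j : Fin t, i ≠ j ∧
        c i * ∏ k, ζ k ^ e i k = c j * ∏ k, ζ k ^ e j k} ≤
      t * (t - 1) / 2 * (D * (Fintype.card F - 1) ^ (n - 1)) := by
  classical
  rw [Nat.card_eq_fintype_card, Fintype.card_subtype, ← card_filter_fst_lt_snd]
  refine le_trans (Finset.card_le_card (t := (Finset.univ.filter
    fun p : Fin t × Fin t => p.1 < p.2).biUnion fun p => Finset.univ.filter
      fun ζ : Fin n → Fˣ => c p.1 * ∏ k, ζ k ^ e p.1 k = c p.2 * ∏ k, ζ k ^ e p.2 k) ?_)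
    (Finset.card_biUnion_le_card_mul _ _ _ fun p hp => ?_)
  · intro ζ hζ
    obtain ⟨i, j, hij, h⟩ := (Finset.mem_filter.1 hζ).2
    simp only [Finset.mem_biUnion, Finset.mem_filter, Finset.mem_univ, true_and]
    rcases hij.lt_or_gt with hlt | hlt
    · exact ⟨(i, j), hlt, h⟩
    · exact ⟨(j, i), hlt, h.symm⟩
  · exact card_monomial_eq_monomial_le _ _ (he.ne (Finset.mem_filter.1 hp).2.ne) (hD _) (hD _)


/-- For `f = ∑ cᵢ mᵢ` with pairwise distinct monomials, nonzero coefficients,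
partial degrees at most `D < q - 1`: the number of `ζ ∈ (Fˣ)ⁿ` with
`cᵢ mᵢ(ζ) = cⱼ mⱼ(ζ)` for some `i ≠ j` is at most `t(t-1)D(q-1)^{n-1}/2`; consequently a
uniformly random `ζ` makes `f(ζ₁x₁, …, ζₙxₙ)` diverse (all coefficients `cᵢ mᵢ(ζ)`
pairwise distinct) with probability at least `1 - t(t-1)D/(2(q-1))`. -/
theorem stmt5 (F : Type*) [Field F] [Fintype F] (q n D t : ℕ)
    (hq : Fintype.card F = q)
    (e : Fin t → Fin n → ℕ) (he : Function.Injective e)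
    (c : Fin t → Fˣ)
    (hD : ∀ i k, e i k ≤ D) (hDq : D < q - 1) :
    Nat.card {ζ : Fin n → Fˣ // ∃ i j : Fin t, i ≠ j ∧
        c i * ∏ k, ζ k ^ e i k = c j * ∏ k, ζ k ^ e j k} ≤
      t * (t - 1) * D * (q - 1) ^ (n - 1) / 2 ∧
    (1 : ℝ) - (t : ℝ) * ((t : ℝ) - 1) * D / (2 * ((q : ℝ) - 1)) ≤
      (Nat.card {ζ : Fin n → Fˣ //
          Function.Injective fun i => c i * ∏ k, ζ k ^ e i k} : ℝ) /
        (((q : ℝ) - 1) ^ n) := by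
  subst hq
  have hbad := card_exists_monomial_eq_le e he c hD
  have heven : t * (t - 1) / 2 * 2 = t * (t - 1) :=
    Nat.div_mul_cancel (Nat.even_mul_pred_self t).two_dvd
  have hfirst : _ ≤ t * (t - 1) * D * (Fintype.card F - 1) ^ (n - 1) / 2 :=
    hbad.trans <| by
      rw [Nat.le_div_iff_mul_le two_pos]
      nth_rewrite 2 [← heven]
      generalize t * (t - 1) / 2 = s
      exact le_of_eq (by ring)
  refine ⟨hfirst, ?_⟩
  set B := Nat.card {ζ : Fin n → Fˣ // ∃ i j : Fin t, i ≠ j ∧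
    c i * ∏ k, ζ k ^ e i k = c j * ∏ k, ζ k ^ e j k} with hB
  set A := Nat.card {ζ : Fin n → Fˣ //
    Function.Injective fun i => c i * ∏ k, ζ k ^ e i k} with hA
  have hsum : A + B = (Fintype.card F - 1) ^ n := by
    classical
    have hcompl : B = Nat.card {ζ : Fin n → Fˣ //
        ¬ Function.Injective fun i => c i * ∏ k, ζ k ^ e i k} := by
      refine Nat.card_congr (Equiv.subtypeEquivRight fun ζ => ?_)
      simp only [Function.Injective, not_forall, exists_prop]
      exact exists₂_congr fun _ _ => and_comm
    rw [hcompl, hA, Nat.card_eq_fintype_card, Nat.card_eq_fintype_card,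
      Fintype.card_subtype_compl, Nat.add_sub_cancel' (Fintype.card_subtype_le _)]
    simp [Fintype.card_units]
  clear_value A B
  have hq1 : 1 ≤ Fintype.card F := by lia
  have hQ : (0 : ℝ) < (Fintype.card F : ℝ) - 1 := by
    have : 1 < Fintype.card F := by lia
    have : (1 : ℝ) < Fintype.card F := by exact_mod_cast this
    linarith
  have hsumR : (A : ℝ) + B = ((Fintype.card F : ℝ) - 1) ^ n := by
    have := congrArg (Nat.cast : ℕ → ℝ) hsum
    push_cast [Nat.cast_sub hq1] at this
    exact this
  have hT : ((t * (t - 1) : ℕ) : ℝ) = (t : ℝ) * ((t : ℝ) - 1) := by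
    cases t <;> simp
  have hBR : 2 * (B : ℝ) * ((Fintype.card F : ℝ) - 1) ≤
      (t : ℝ) * ((t : ℝ) - 1) * D * ((Fintype.card F : ℝ) - 1) ^ n := by
    have h2 : 2 * B ≤ t * (t - 1) * D * (Fintype.card F - 1) ^ (n - 1) := by
      have := Nat.mul_le_mul_left 2 hfirst
      exact this.trans (Nat.mul_div_le _ _)
    cases n with
    | zero =>
      have ht : t ≤ 1 := by
        simpa using Fintype.card_le_of_injective e he
      have ht0 : t * (t - 1) = 0 := by
        interval_cases t <;> rfl
      have hB0 : B = 0 := by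
        rw [ht0] at h2
        lia
      rw [← hT, ht0, hB0]
      simp
    | succ m =>
      have h2R : ((2 * B : ℕ) : ℝ) ≤ _ := Nat.cast_le.2 h2
      rw [Nat.cast_mul, Nat.cast_mul, Nat.cast_mul, hT, Nat.add_sub_cancel, Nat.cast_pow,
        Nat.cast_sub hq1, Nat.cast_one, Nat.cast_ofNat] at h2R
      rw [pow_succ, ← mul_assoc]
      exact mul_le_mul_of_nonneg_right h2R hQ.le
  have hdiv : (B : ℝ) / ((Fintype.card F : ℝ) - 1) ^ n ≤
      (t : ℝ) * ((t : ℝ) - 1) * D / (2 * ((Fintype.card F : ℝ) - 1)) := by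
    rw [div_le_div_iff₀ (by positivity) (by positivity)]
    linarith
  have hone : (A : ℝ) / ((Fintype.card F : ℝ) - 1) ^ n +
      (B : ℝ) / ((Fintype.card F : ℝ) - 1) ^ n = 1 := by
    rw [← add_div, hsumR, div_self (by positivity)]
  linarith
end

section
/- Let F_q be a finite field with q elements and let f = c_1 m_1 + ⋯ + c_t m_t be an n-variable polynomial over F_q (n ≥ 1) with pairwise distinct monomials m_i, nonzero coefficients c_i, and all partial degrees at most D with D ≥ 1. Let ω ∈ F_q^* and let T ≥ t with T ≥ 1. If q ≥ 2(n+2)T²D + 1, then for (α_1, …, α_n, ζ_1, …, ζ_n) chosen uniformly at random from (F_q^*)^{2n}, with probability at least 3/4 all three of the following hold: (A1) the values m_i(α_1, …, α_n), i = 1, …, t, are pairwise distinct; (A2) for every k ∈ {1, …, n}, the values m_i(α_1, …, α_{k−1}, α_k ω, α_{k+1}, …, α_n), i = 1, …, t, are pairwise distinct; (A3) the values c_i · m_i(ζ_1, …, ζ_n), i = 1, …, t, are pairwise distinct. -/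
open Finset in
theorem card_mul_pow_eq_mul_pow_le {F : Type*} [Field F] [Fintype F] [DecidableEq F]
    {u v D : ℕ} (huv : u ≠ v) (hu : u ≤ D) (hv : v ≤ D) (a b : Fˣ) :
    #{x : Fˣ | a * x ^ u = b * x ^ v} ≤ D := by
  wlog h : u < v generalizing u v a b
  · simpa only [eq_comm] using this huv.symm hv hu b a (by omega)
  have hroots : ∀ x ∈ ({x : Fˣ | a * x ^ u = b * x ^ v} : Finset Fˣ),
      (x : F) ∈ (Polynomial.nthRoots (v - u) ((a / b : Fˣ) : F)).toFinset := by
    intro x hx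
    rw [Multiset.mem_toFinset, Polynomial.mem_nthRoots (by omega), ← Units.val_pow_eq_pow_val,
      Units.val_inj, eq_div_iff_mul_eq']
    have hx' : a * x ^ u = b * x ^ v := (mem_filter.1 hx).2
    rw [← Nat.sub_add_cancel h.le, pow_add, ← mul_assoc] at hx'
    exact (mul_right_cancel hx').symm ▸ mul_comm _ _
  calc _ ≤ #(Polynomial.nthRoots (v - u) ((a / b : Fˣ) : F)).toFinset :=
        card_le_card_of_injOn _ hroots Units.val_injective.injOn
    _ ≤ v - u := (Multiset.toFinset_card_le _).trans (Polynomial.card_nthRoots _ _)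
    _ ≤ D := by omega

open Finset in
/-- On the torus, two distinct terms with partial degrees at most `D` agree at a fraction of at
most `D / |Fˣ|` of the points. -/
theorem card_term_eq_term_mul_le {F : Type*} [Field F] [Fintype F] [DecidableEq F]
    {ι : Type*} [Fintype ι] [DecidableEq ι] {D : ℕ} {u v : ι → ℕ} (huv : u ≠ v)
    (hu : ∀ k, u k ≤ D) (hv : ∀ k, v k ≤ D) (a b : Fˣ) :
    #{x : ι → Fˣ | a * ∏ k, x k ^ u k = b * ∏ k, x k ^ v k} * Fintype.card Fˣ ≤
      D * Fintype.card Fˣ ^ Fintype.card ι := by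
  obtain ⟨k, hk⟩ := Function.ne_iff.1 huv
  set S : Finset (ι → Fˣ) := {x : ι → Fˣ | a * ∏ k, x k ^ u k = b * ∏ k, x k ^ v k}
  let f : (ι → Fˣ) → ({j // j ≠ k} → Fˣ) := fun x j ↦ x j
  have hfiber : ∀ y ∈ S.image f, #{x ∈ S | f x = y} ≤ D := by
    intro y _
    refine le_trans (card_le_card_of_injOn (fun x ↦ x k) ?_ ?_)
      (card_mul_pow_eq_mul_pow_le hk (hu k) (hv k)
        (a * ∏ j : {j // j ≠ k}, y j ^ u j) (b * ∏ j : {j // j ≠ k}, y j ^ v j))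
    · intro x hx
      obtain ⟨hxS, rfl⟩ := mem_filter.1 hx
      have hx' := (mem_filter.1 hxS).2
      rw [Fintype.prod_eq_mul_prod_subtype_ne _ k, Fintype.prod_eq_mul_prod_subtype_ne _ k] at hx'
      simp only [coe_filter, mem_univ, true_and, Set.mem_ofPred_eq, f]
      rw [mul_assoc, mul_assoc, mul_comm _ (x k ^ u k), mul_comm _ (x k ^ v k)]
      exact hx'
    · intro x hx x' hx' h
      ext1 j
      by_cases hj : j = k
      · exact hj ▸ h
      · exact congrFun ((mem_filter.1 hx).2.trans (mem_filter.1 hx').2.symm) ⟨j, hj⟩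
  have himage : #(S.image f) ≤ Fintype.card Fˣ ^ (Fintype.card ι - 1) := by
    refine (card_le_univ _).trans_eq ?_
    simp [Fintype.card_subtype_compl]
  have hι : Fintype.card ι ≠ 0 := (Fintype.card_pos_iff.2 ⟨k⟩).ne'
  calc _ ≤ D * Fintype.card Fˣ ^ (Fintype.card ι - 1) * Fintype.card Fˣ := by
        gcongr
        exact (card_le_mul_card_image S D hfiber).trans (by gcongr)
    _ = _ := by rw [mul_assoc, pow_sub_one_mul hι]

open Finset in
/-- On the torus, `t` terms with distinct exponents and partial degrees at most `D` fail to take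
distinct values at a fraction of at most `t² D / (2 |Fˣ|)` of the points. -/
theorem two_mul_card_not_injective_term_mul_le {F : Type*} [Field F] [Fintype F] [DecidableEq F]
    {ι : Type*} [Fintype ι] [DecidableEq ι] {D t : ℕ} {e : Fin t → ι → ℕ}
    (he : Function.Injective e) (hD : ∀ i k, e i k ≤ D) (c : Fin t → Fˣ) :
    2 * #{x : ι → Fˣ | ¬ Function.Injective fun i ↦ c i * ∏ k, x k ^ e i k} *
      Fintype.card Fˣ ≤ t ^ 2 * D * Fintype.card Fˣ ^ Fintype.card ι := by
  set P : Finset (Fin t × Fin t) := {p | p.1 < p.2}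
  set Q : Finset (Fin t × Fin t) := {p | p.2 < p.1}
  have hP : 2 * #P ≤ t ^ 2 := by
    have hswap : #P = #Q :=
      card_equiv (Equiv.prodComm _ _) (by simp [P, Q])
    have hdisj : Disjoint P Q :=
      disjoint_filter.2 fun p _ h ↦ h.le.not_gt
    rw [two_mul]
    nth_rewrite 2 [hswap]
    rw [← card_union_of_disjoint hdisj]
    simpa [sq] using card_le_univ (P ∪ Q)
  have hsub : ({x : ι → Fˣ | ¬ Function.Injective fun i ↦ c i * ∏ k, x k ^ e i k} : Finset _) ⊆
      P.biUnion fun p ↦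
        {x | c p.1 * ∏ k, x k ^ e p.1 k = c p.2 * ∏ k, x k ^ e p.2 k} := by
    intro x hx
    simp only [Function.Injective, mem_filter, mem_univ, true_and, not_forall] at hx
    obtain ⟨i, j, hij, hne⟩ := hx
    simp only [mem_biUnion, mem_filter, mem_univ, true_and, P, Prod.exists]
    rcases lt_or_gt_of_ne hne with h | h
    · exact ⟨i, j, h, hij⟩
    · exact ⟨j, i, h, hij.symm⟩
  have hbad : #{x : ι → Fˣ | ¬ Function.Injective fun i ↦ c i * ∏ k, x k ^ e i k} *
      Fintype.card Fˣ ≤ #P * (D * Fintype.card Fˣ ^ Fintype.card ι) := by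
    refine (Nat.mul_le_mul_right _ ((card_le_card hsub).trans card_biUnion_le)).trans ?_
    rw [sum_mul]
    refine sum_le_card_nsmul _ _ _ fun p hp ↦ ?_
    exact card_term_eq_term_mul_le (he.ne (mem_filter.1 hp).2.ne) (hD _) (hD _) _ _
  calc _ ≤ 2 * #P * (D * Fintype.card Fˣ ^ Fintype.card ι) := by
        rw [mul_assoc, mul_assoc]; gcongr
    _ ≤ t ^ 2 * (D * Fintype.card Fˣ ^ Fintype.card ι) := by gcongr
    _ = _ := by ring

/-- For a sparse polynomial `f = ∑ cᵢ mᵢ` over a finite field with `q` elements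
(`n ≥ 1` variables, partial degrees ≤ `D`, `D ≥ 1`), `ω ∈ Fˣ`, `T ≥ t`, `T ≥ 1`, and
`q ≥ 2(n+2)T²D + 1`, a uniformly random `(α, ζ) ∈ (Fˣ)^{2n}` satisfies Assumptions 1, 2, 3
with probability at least `3/4`. -/
theorem stmt6 (F : Type*) [Field F] [Fintype F] (q n D t T : ℕ)
    (hq : Fintype.card F = q) (hn : 1 ≤ n) (hD1 : 1 ≤ D)
    (e : Fin t → Fin n → ℕ) (he : Function.Injective e)
    (c : Fin t → Fˣ)
    (hD : ∀ i k, e i k ≤ D)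
    (ω : Fˣ) (hT : t ≤ T) (hT1 : 1 ≤ T)
    (hqbound : 2 * (n + 2) * T ^ 2 * D + 1 ≤ q) :
    (3 : ℝ) / 4 ≤
      (Nat.card {p : (Fin n → Fˣ) × (Fin n → Fˣ) //
        (Function.Injective fun i => ∏ k, (p.1 k) ^ e i k) ∧
        (∀ k0 : Fin n, Function.Injective fun i =>
          ∏ k, (if k = k0 then p.1 k * ω else p.1 k) ^ e i k) ∧
        (Function.Injective fun i => c i * ∏ k, (p.2 k) ^ e i k)} : ℝ) /
        (((q : ℝ) - 1) ^ (2 * n)) := by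
  classical
  set N := Fintype.card Fˣ with hNdef
  have hN : N + 1 = q := by
    rw [hNdef, ← hq, Fintype.card_eq_card_units_add_one (α := F)]
  let bad (c : Fin t → Fˣ) : Finset (Fin n → Fˣ) :=
    {x | ¬ Function.Injective fun i ↦ c i * ∏ k, x k ^ e i k}
  have hbad (c : Fin t → Fˣ) : 2 * (bad c).card * N ≤ T ^ 2 * D * N ^ n := by
    have h := two_mul_card_not_injective_term_mul_le he hD c
    rw [Fintype.card_fin] at h
    exact h.trans (by gcongr)
  let good : Finset ((Fin n → Fˣ) × (Fin n → Fˣ)) := {p |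
    (Function.Injective fun i => ∏ k, (p.1 k) ^ e i k) ∧
    (∀ k0 : Fin n, Function.Injective fun i =>
      ∏ k, (if k = k0 then p.1 k * ω else p.1 k) ^ e i k) ∧
    (Function.Injective fun i => c i * ∏ k, (p.2 k) ^ e i k)}
  have hshift (x : Fin n → Fˣ) (k0 : Fin n) (i : Fin t) :
      ∏ k, (if k = k0 then x k * ω else x k) ^ e i k = ω ^ e i k0 * ∏ k, x k ^ e i k := by
    have hω : ω ^ e i k0 = ∏ k, if k = k0 then ω ^ e i k else 1 := by simp
    rw [hω, ← Finset.prod_mul_distrib]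
    refine Finset.prod_congr rfl fun k _ ↦ ?_
    split_ifs <;> simp [mul_pow, mul_comm]
  let badShift : Finset (Fin n → Fˣ) := Finset.univ.biUnion fun k0 ↦ bad fun i ↦ ω ^ e i k0
  have hcompl : goodᶜ ⊆ (bad 1 ∪ badShift) ×ˢ Finset.univ ∪ Finset.univ ×ˢ bad c := by
    intro p hp
    simp only [good, hshift, Finset.mem_compl, Finset.mem_filter, Finset.mem_univ,
      true_and] at hp
    simp only [bad, badShift, Finset.mem_union, Finset.mem_product, Finset.mem_univ, and_true,
      true_and, Finset.mem_biUnion, Finset.mem_filter, Pi.one_apply, one_mul]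
    by_contra h
    push Not at h
    exact hp ⟨h.1.1, h.1.2, h.2⟩
  have hcard : goodᶜ.card ≤
      ((bad 1).card + ∑ k0, (bad fun i ↦ ω ^ e i k0).card) * N ^ n + N ^ n * (bad c).card := by
    have huniv : (Finset.univ : Finset (Fin n → Fˣ)).card = N ^ n := by simp [N]
    refine (Finset.card_le_card hcompl).trans ((Finset.card_union_le _ _).trans ?_)
    rw [Finset.card_product, Finset.card_product, huniv]
    gcongr
    exact (Finset.card_union_le _ _).trans (by gcongr; exact Finset.card_biUnion_le)
  have hsum : 2 * (∑ k0, (bad fun i ↦ ω ^ e i k0).card) * N ≤ n * (T ^ 2 * D * N ^ n) := by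
    rw [Finset.mul_sum, Finset.sum_mul]
    simpa using Finset.sum_le_card_nsmul Finset.univ _ _ fun k0 _ ↦ hbad fun i ↦ ω ^ e i k0
  have hNpos : 0 < N := Fintype.card_pos
  have hquarter : 4 * goodᶜ.card ≤ N ^ (2 * n) := by
    have htotal : 2 * goodᶜ.card * N ≤ (n + 2) * T ^ 2 * D * N ^ (2 * n) := by
      calc _ ≤ 2 * (((bad 1).card + ∑ k0, (bad fun i ↦ ω ^ e i k0).card) * N ^ n +
            N ^ n * (bad c).card) * N := by gcongr
        _ = (2 * (bad 1).card * N + 2 * (∑ k0, (bad fun i ↦ ω ^ e i k0).card) * N +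
            2 * (bad c).card * N) * N ^ n := by ring
        _ ≤ (T ^ 2 * D * N ^ n + n * (T ^ 2 * D * N ^ n) + T ^ 2 * D * N ^ n) * N ^ n := by
          exact Nat.mul_le_mul_right _ (add_le_add (add_le_add (hbad 1) hsum) (hbad c))
        _ = _ := by ring
    refine Nat.le_of_mul_le_mul_right ?_ hNpos
    calc 4 * goodᶜ.card * N = 2 * (2 * goodᶜ.card * N) := by ring
      _ ≤ 2 * ((n + 2) * T ^ 2 * D * N ^ (2 * n)) := by gcongr
      _ = N ^ (2 * n) * (2 * (n + 2) * T ^ 2 * D) := by ring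
      _ ≤ N ^ (2 * n) * N := by gcongr; omega
  have hall : good.card + goodᶜ.card = N ^ (2 * n) := by
    rw [Finset.card_add_card_compl]
    simp [N, two_mul, pow_add]
  have hqN : (q : ℝ) - 1 = N := by rw [← hN]; push_cast; ring
  rw [Nat.card_eq_fintype_card, Fintype.card_subtype, hqN, le_div_iff₀ (by positivity)]
  have hfinal : 3 * N ^ (2 * n) ≤ 4 * good.card := by omega
  have hreal : (3 : ℝ) * N ^ (2 * n) ≤ 4 * good.card := by exact_mod_cast hfinal
  change 3 / 4 * (N : ℝ) ^ (2 * n) ≤ good.card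
  linarith
end

section
/- Let F be a field, let v_1, …, v_t be pairwise distinct elements of F, let c̃_1, …, c̃_t be nonzero elements of F, and define a_j = Σ_{l=1}^t c̃_l v_l^j for j ≥ 0. Then the t×t matrix A_t with (i,j) entry a_{t−i+j−1} (rows and columns indexed 1 through t) is nonsingular, i.e., det A_t ≠ 0. -/
/-- With pairwise distinct `v₁, …, v_t`, nonzero `c̃₁, …, c̃_t` and
`a_j = ∑ₗ c̃ₗ vₗʲ`, the `t×t` matrix with `(i,j)` entry `a_{t-i+j-1}` (1-indexed;
0-indexed `a ((t - 1 - i) + j)`) is nonsingular. -/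
theorem stmt10 (F : Type*) [Field F] (t : ℕ) (v c : Fin t → F)
    (hv : Function.Injective v) (hc : ∀ l, c l ≠ 0)
    (a : ℕ → F) (ha : ∀ j, a j = ∑ l, c l * v l ^ j)
    (A : Matrix (Fin t) (Fin t) F)
    (hA : ∀ i j : Fin t, A i j = a (t - 1 - (i : ℕ) + (j : ℕ))) :
    A.det ≠ 0 := by
  have hfac : A = ((Matrix.vandermonde v).transpose * Matrix.diagonal c *
      Matrix.vandermonde v).submatrix Fin.revPerm id := by
    ext i j
    rw [hA, ha, Matrix.submatrix_apply, Matrix.mul_apply]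
    refine Finset.sum_congr rfl fun l _ => ?_
    have hi : t - 1 - (i : ℕ) = t - (i + 1) := by omega
    rw [Matrix.mul_diagonal, Matrix.transpose_apply, Matrix.vandermonde_apply,
      Matrix.vandermonde_apply, Fin.revPerm_apply, Fin.val_rev, id, hi, pow_add]
    ring
  have hV := Matrix.det_vandermonde_ne_zero_iff.mpr hv
  rw [hfac, Matrix.det_permute, Matrix.det_mul, Matrix.det_mul, Matrix.det_transpose,
    Matrix.det_diagonal]
  refine mul_ne_zero ?_ (mul_ne_zero (mul_ne_zero hV
    (Finset.prod_ne_zero_iff.mpr fun l _ => hc l)) hV)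
  exact ((Equiv.Perm.sign Fin.revPerm).isUnit.map (Int.castRingHom F)).ne_zero
end

section
/- Let F be a field, let v_1, …, v_t be pairwise distinct elements of F, let c̃_1, …, c̃_t be nonzero elements of F, and define a_j = Σ_{l=1}^t c̃_l v_l^j for j ≥ 0. For any T ≥ t, let H be the T×T Hankel matrix with (i,j) entry a_{i+j−2} (rows and columns indexed 1 through T). Then the rank of H is exactly t. In particular, if the number T used to build the matrix exceeds the number t of summands, the matrix H is singular. -/
open Matrix in
/-- With pairwise distinct `v₁, …, v_t`, nonzero `c̃₁, …, c̃_t`,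
`a_j = ∑ₗ c̃ₗ vₗʲ`, and `T ≥ t`, the `T×T` Hankel matrix `H` with `(i,j)` entry
`a_{i+j-2}` (1-indexed; 0-indexed `a (i + j)`) has rank exactly `t`; in particular if
`t < T` then `H` is singular. -/
theorem stmt11 (F : Type*) [Field F] (t T : ℕ) (htT : t ≤ T)
    (v c : Fin t → F) (hv : Function.Injective v) (hc : ∀ l, c l ≠ 0)
    (a : ℕ → F) (ha : ∀ j, a j = ∑ l, c l * v l ^ j)
    (H : Matrix (Fin T) (Fin T) F)
    (hH : ∀ i j : Fin T, H i j = a ((i : ℕ) + (j : ℕ))) :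
    H.rank = t ∧ (t < T → H.det = 0) := by
  have hrank : H.rank = t := by
    apply le_antisymm
    · have hfac : H = (rectVandermonde v 1 T)ᵀ * (diagonal c * rectVandermonde v 1 T) := by
        ext i j
        rw [hH, ha, mul_apply]
        refine Finset.sum_congr rfl fun l _ => ?_
        simp only [diagonal_mul, transpose_apply, rectVandermonde_apply, Pi.one_apply, one_pow,
          mul_one]
        ring
      rw [hfac]
      exact (rank_mul_le_left _ _).trans (rank_le_width _)
    · have hsub : H.submatrix (Fin.castLE htT) (Fin.castLE htT) =
          (vandermonde v)ᵀ * (diagonal c * vandermonde v) := by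
        ext i j
        rw [submatrix_apply, hH, ha, mul_apply]
        refine Finset.sum_congr rfl fun l _ => ?_
        simp only [diagonal_mul, transpose_apply, vandermonde_apply, Fin.val_castLE]
        ring
      have hdet : ((vandermonde v)ᵀ * (diagonal c * vandermonde v)).det ≠ 0 := by
        have hV := det_vandermonde_ne_zero_iff.2 hv
        rw [det_mul, det_mul, det_transpose, det_diagonal]
        exact mul_ne_zero hV (mul_ne_zero (Finset.prod_ne_zero_iff.2 fun l _ => hc l) hV)
      have hfull := rank_of_isUnit _ ((isUnit_iff_isUnit_det _).2 hdet.isUnit)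
      rw [← hsub, Fintype.card_fin] at hfull
      exact hfull.ge.trans (rank_submatrix_le _ _ _)
  refine ⟨hrank, fun hlt => ?_⟩
  by_contra hdet
  have hfull := rank_of_isUnit H ((isUnit_iff_isUnit_det H).2 (Ne.isUnit hdet))
  rw [hrank, Fintype.card_fin] at hfull
  exact hlt.ne hfull
end
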